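/- arXiv:1808.00319 — 3 statements merged into one kernel-verified Lean document; each statement's English description precedes it below -/
import Mathlib

section
/- Let N ≥ 2, β > 0, m > 0 and let V : ℝ → ℝ be a C²-smooth potential growing faster than log|λ| at infinity so that the normalizing constant Z_N = ∫_{ℝ^N} ∏_{j>k} |λ_j − λ_k|^β exp(−m Σ_j V(λ_j)) ∏_j dλ_j is finite. Assume that the one-point correlation function R_{N,1} is differentiable at λ ∈ ℝ and that ∫_ℝ R_{N,2}(λ,λ')/(λ−λ') dλ' converges absolutely. Then for every such λ one has β ∫_ℝ R_{N,2}(λ,λ')/(λ−λ') dλ' = m V'(λ) R_{N,1}(λ) + R_{N,1}'(λ). -/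
open MeasureTheory Finset

/-- The unnormalised Gibbs weight of the 1D log-gas. -/
noncomputable def weight1D (N : ℕ) (β m : ℝ) (V : ℝ → ℝ) (lam : Fin N → ℝ) : ℝ :=
  (∏ j : Fin N, ∏ k ∈ Finset.univ.filter (fun k => k < j), |lam j - lam k| ^ β) *
    Real.exp (-m * ∑ j, V (lam j))

/-- The partition function `Z_N`. -/
noncomputable def Z1D (N : ℕ) (β m : ℝ) (V : ℝ → ℝ) : ℝ :=
  ∫ lam : Fin N → ℝ, weight1D N β m V lam

/-- The Gibbs probability density `p_N` on `ℝ^N`. -/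
noncomputable def p1D (N : ℕ) (β m : ℝ) (V : ℝ → ℝ) (lam : Fin N → ℝ) : ℝ :=
  (Z1D N β m V)⁻¹ * weight1D N β m V lam

/-- The one-point correlation function `R_{N,1}` for `N = n + 2` particles. -/
noncomputable def R1' (n : ℕ) (β m : ℝ) (V : ℝ → ℝ) (x : ℝ) : ℝ :=
  (n + 2 : ℝ) * ∫ lam : Fin (n + 1) → ℝ, p1D (n + 2) β m V (Fin.cons x lam)

/-- The two-point correlation function `R_{N,2}` for `N = n + 2` particles. -/
noncomputable def R2' (n : ℕ) (β m : ℝ) (V : ℝ → ℝ) (x y : ℝ) : ℝ :=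
  ((n + 2 : ℝ) * (n + 1 : ℝ)) *
    ∫ lam : Fin n → ℝ, p1D (n + 2) β m V (Fin.cons x (Fin.cons y lam))

/-! ### Elementary properties of the Gibbs weight -/

theorem weight1D_cons (k : ℕ) (β m : ℝ) (V : ℝ → ℝ) (x : ℝ) (lam : Fin k → ℝ) :
    weight1D (k + 1) β m V (Fin.cons x lam) =
      Real.exp (-m * V x) * ((∏ j, |x - lam j| ^ β) * weight1D k β m V lam) := by
  simp only [weight1D, Finset.prod_filter, Fin.prod_univ_succ, Fin.sum_univ_succ, Fin.cons_zero,
    Fin.cons_succ, Fin.succ_lt_succ_iff, Fin.succ_pos, Fin.not_lt_zero, if_true, if_false,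
    Finset.prod_const_one, Finset.prod_mul_distrib, mul_add, Real.exp_add, abs_sub_comm x]
  ring

theorem weight1D_nonneg (k : ℕ) (β m : ℝ) (V : ℝ → ℝ) (lam : Fin k → ℝ) :
    0 ≤ weight1D k β m V lam := by
  unfold weight1D; positivity

theorem continuous_weight1D (k : ℕ) {β : ℝ} (hβ : 0 ≤ β) (m : ℝ) {V : ℝ → ℝ}
    (hV : Continuous V) : Continuous (weight1D k β m V) := by
  unfold weight1D
  refine .mul (continuous_finsetProd _ fun j _ => continuous_finsetProd _ fun l _ => ?_) ?_
  · exact Continuous.rpow_const (by fun_prop) fun _ => .inr hβ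
  · fun_prop

theorem weight1D_eq_abs_det_vandermonde (k : ℕ) (β m : ℝ) (V : ℝ → ℝ) (lam : Fin k → ℝ) :
    weight1D k β m V lam =
      |(Matrix.vandermonde lam).det| ^ β * Real.exp (-m * ∑ j, V (lam j)) := by
  unfold weight1D
  congr 1
  rw [Matrix.det_vandermonde, Finset.abs_prod, ← Real.finsetProd_rpow _ _ fun _ _ => abs_nonneg _]
  simp_rw [Finset.abs_prod]
  have h : ∀ i : Fin k, (∏ j ∈ Ioi i, |lam j - lam i|) ^ β = ∏ j ∈ Ioi i, |lam j - lam i| ^ β :=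
    fun i => (Real.finsetProd_rpow _ _ (fun _ _ => abs_nonneg _) _).symm
  simp_rw [h]
  exact Finset.prod_comm' (by simp)

theorem weight1D_comp_perm (k : ℕ) (β m : ℝ) (V : ℝ → ℝ) (lam : Fin k → ℝ)
    (σ : Equiv.Perm (Fin k)) : weight1D k β m V (lam ∘ σ) = weight1D k β m V lam := by
  have h : Matrix.vandermonde (lam ∘ σ) = (Matrix.vandermonde lam).submatrix σ id := by
    ext i j; simp [Matrix.vandermonde_apply]
  have hs : |((Equiv.Perm.sign σ : ℤ) : ℝ)| = 1 := by
    rcases Int.units_eq_one_or (Equiv.Perm.sign σ) with h | h <;> simp [h]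
  rw [weight1D_eq_abs_det_vandermonde, weight1D_eq_abs_det_vandermonde, h, Matrix.det_permute,
    abs_mul, hs, one_mul]
  simp only [Function.comp_apply, Equiv.sum_comp σ fun j => V (lam j)]

/-! ### Change of variables on `Fin k → ℝ` -/

theorem measurePreserving_comp_perm {k : ℕ} (σ : Equiv.Perm (Fin k)) :
    MeasurePreserving (fun lam : Fin k → ℝ => lam ∘ σ) :=
  volume_preserving_arrowCongr' σ.symm (.refl ℝ) (.id volume)

theorem measurableEmbedding_comp_perm {k : ℕ} (σ : Equiv.Perm (Fin k)) :
    MeasurableEmbedding (fun lam : Fin k → ℝ => lam ∘ σ) :=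
  (MeasurableEquiv.arrowCongr' σ.symm (.refl ℝ)).measurableEmbedding

theorem measurePreserving_finCons (k : ℕ) :
    MeasurePreserving (fun p : ℝ × (Fin k → ℝ) => (Fin.cons p.1 p.2 : Fin (k + 1) → ℝ)) := by
  have h := (volume_preserving_piFinSuccAbove (fun _ : Fin (k + 1) => ℝ) 0).symm
  convert h using 1
  ext p i
  simp [MeasurableEquiv.piFinSuccAbove, Fin.insertNthEquiv]

theorem measurableEmbedding_finCons (k : ℕ) :
    MeasurableEmbedding (fun p : ℝ × (Fin k → ℝ) => (Fin.cons p.1 p.2 : Fin (k + 1) → ℝ)) := by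
  have h := (MeasurableEquiv.piFinSuccAbove (fun _ : Fin (k + 1) => ℝ) 0).symm.measurableEmbedding
  convert h using 1
  ext p i
  simp [MeasurableEquiv.piFinSuccAbove, Fin.insertNthEquiv]

theorem integrable_finCons_iff {k : ℕ} {f : (Fin (k + 1) → ℝ) → ℝ} :
    Integrable (fun p : ℝ × (Fin k → ℝ) => f (Fin.cons p.1 p.2))
      ((volume : Measure ℝ).prod volume) ↔ Integrable f :=
  (measurePreserving_finCons k).integrable_comp_emb (measurableEmbedding_finCons k)

theorem integral_finCons {k : ℕ} {f : (Fin (k + 1) → ℝ) → ℝ} (hf : Integrable f) :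
    ∫ y, ∫ lam : Fin k → ℝ, f (Fin.cons y lam) = ∫ lam, f lam := by
  rw [← (measurePreserving_finCons k).integral_comp (measurableEmbedding_finCons k),
    Measure.volume_eq_prod, integral_prod _ (integrable_finCons_iff.2 hf)]

/-! ### Polynomial moments of the Gibbs weight -/

/-- Among `k + 1` points, one from each interval `(i, i + 1/2)`, at least one is at distance
comparable to `1 + |lam j|` from each of the `k` points `lam j`. -/
theorem exists_forall_le_abs_sub {k : ℕ} {t : Fin (k + 1) → ℝ}
    (ht : ∀ i : Fin (k + 1), t i ∈ Set.Ioo (i : ℝ) (i + 1 / 2)) (lam : Fin k → ℝ) :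
    ∃ i, ∀ j, 1 + |lam j| ≤ 8 * (k + 2) * |t i - lam j| := by
  by_contra! h
  choose f hf using h
  obtain ⟨i, i', hne, hff⟩ := Fintype.exists_ne_map_eq_of_card_lt f (by simp)
  wlog hlt : i < i' generalizing i i'
  · exact this i' i hne.symm hff.symm (lt_of_le_of_ne (not_lt.1 hlt) hne.symm)
  have h1 := hf i
  have h2 := hf i'
  rw [← hff] at h2
  set y := lam (f i)
  have hi := ht i
  have hi' := ht i'
  have hlt' : (i : ℝ) + 1 ≤ (i' : ℝ) := by exact_mod_cast hlt
  have hk : (i' : ℝ) ≤ k := by exact_mod_cast Nat.lt_succ_iff.1 i'.2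
  have h0 : (0 : ℝ) ≤ (i : ℝ) := by positivity
  have h3 : 1 / 2 ≤ |t i - y| + |t i' - y| := by
    have := abs_sub_le (t i') y (t i)
    rw [abs_sub_comm y] at this
    have := le_abs_self (t i' - t i)
    linarith [hi.2, hi'.1]
  have h4 : |y| ≤ |t i - y| + (k + 1) := by
    have := abs_sub_abs_le_abs_sub y (t i)
    rw [abs_sub_comm y, abs_of_pos (show 0 < t i by linarith [hi.1])] at this
    linarith [hi.2]
  have hk0 : (0 : ℝ) ≤ k := by positivity
  have h5 : 2 * (k : ℝ) + 3 < |y| := by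
    have := mul_le_mul_of_nonneg_left h3 (show (0 : ℝ) ≤ 8 * (k + 2) by positivity)
    linarith
  have h6 : (k : ℝ) + 2 < |t i - y| := by linarith
  nlinarith

/-- If the Gibbs weight for `k + 1` particles has moments of order `p` in each particle, then the
weight for `k` particles has moments of order `p + β`. -/
theorem integrable_moment_weight1D {k : ℕ} {β m p : ℝ} {V : ℝ → ℝ} (hβ : 0 ≤ β)
    (hV : Continuous V)
    (h : Integrable fun lam : Fin (k + 1) → ℝ =>
      (∏ j, (1 + |lam j|) ^ p) * weight1D (k + 1) β m V lam) :
    Integrable fun lam : Fin k → ℝ => (∏ j, (1 + |lam j|) ^ (p + β)) * weight1D k β m V lam := by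
  have hslice : ∀ᵐ y : ℝ, Integrable fun lam : Fin k → ℝ =>
      (∏ j, |y - lam j| ^ β) * ((∏ j, (1 + |lam j|) ^ p) * weight1D k β m V lam) := by
    filter_upwards [(integrable_finCons_iff.2 h).prod_right_ae] with y hy
    refine (hy.const_mul (((1 + |y|) ^ p * Real.exp (-m * V y))⁻¹)).congr (.of_forall fun lam => ?_)
    have : 0 < (1 + |y|) ^ p := by positivity
    simp only [weight1D_cons, Fin.prod_univ_succ, Fin.cons_zero, Fin.cons_succ]
    field_simp
  have hex : ∀ i : Fin (k + 1), ∃ y ∈ {y : ℝ | Integrable fun lam : Fin k → ℝ =>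
      (∏ j, |y - lam j| ^ β) * ((∏ j, (1 + |lam j|) ^ p) * weight1D k β m V lam)},
      y ∈ Set.Ioo (i : ℝ) (i + 1 / 2) :=
    fun i => (Measure.dense_of_ae hslice).exists_between (by linarith)
  choose t ht1 ht2 using hex
  refine ((integrable_finsetSum univ fun i _ => ht1 i).const_mul
    (∏ _j : Fin k, (8 * (k + 2 : ℝ)) ^ β)).mono' ?_ (.of_forall fun lam => ?_)
  · refine (Continuous.mul (continuous_finsetProd _ fun j _ => ?_)
      (continuous_weight1D k hβ m hV)).aestronglyMeasurable
    exact Continuous.rpow_const (by fun_prop) fun lam => .inl (by positivity)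
  · have hw := weight1D_nonneg k β m V lam
    obtain ⟨i, hi⟩ := exists_forall_le_abs_sub ht2 lam
    rw [Real.norm_of_nonneg (by positivity)]
    calc _ ≤ (∏ j, ((8 * (k + 2 : ℝ)) ^ β * |t i - lam j| ^ β * (1 + |lam j|) ^ p)) *
          weight1D k β m V lam := by
          gcongr with j
          rw [Real.rpow_add (by positivity), mul_comm, ← Real.mul_rpow (by positivity) (by positivity)]
          gcongr
          exact hi j
      _ = (∏ _j : Fin k, (8 * (k + 2 : ℝ)) ^ β) * ((∏ j, |t i - lam j| ^ β) *
          ((∏ j, (1 + |lam j|) ^ p) * weight1D k β m V lam)) := by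
          simp only [Finset.prod_mul_distrib]; ring
      _ ≤ _ := by
          gcongr
          exact Finset.single_le_sum (f := fun i => (∏ j, |t i - lam j| ^ β) *
            ((∏ j, (1 + |lam j|) ^ p) * weight1D k β m V lam))
            (fun i _ => by positivity) (Finset.mem_univ i)

/-! ### Estimates on powers and products -/

theorem rpow_sub_rpow_le {β s c : ℝ} (hβ : 0 < β) (hs : 0 ≤ s) (hsc : s ≤ c) (hc : 0 < c) :
    c ^ β - s ^ β ≤ max β 1 * c ^ (β - 1) * (c - s) := by
  obtain ⟨t, rfl⟩ : ∃ t, s = c * t := ⟨s / c, by field_simp⟩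
  have ht0 : 0 ≤ t := nonneg_of_mul_nonneg_right hs hc
  have ht1 : t ≤ 1 := by nlinarith
  have key : 1 - t ^ β ≤ max β 1 * (1 - t) := by
    rcases le_total β 1 with h | h
    · have := Real.rpow_le_rpow_of_exponent_ge' ht0 ht1 hβ.le h
      rw [Real.rpow_one] at this
      rw [max_eq_right h]; linarith
    · have := one_add_mul_self_le_rpow_one_add (s := t - 1) (by linarith) h
      rw [add_sub_cancel] at this
      rw [max_eq_left h]; linarith
  have hcβ : c ^ β = c ^ (β - 1) * c := by rw [Real.rpow_sub_one hc.ne']; field_simp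
  rw [Real.mul_rpow hc.le ht0]
  calc c ^ β - c ^ β * t ^ β = c ^ β * (1 - t ^ β) := by ring
    _ ≤ c ^ β * (max β 1 * (1 - t)) := by gcongr
    _ = _ := by rw [hcβ]; ring

theorem rpow_sub_one_le {β a c M : ℝ} (hβ : 0 < β) (ha : 0 < a) (hac : a ≤ c) (hcM : c ≤ M)
    (hM : 1 ≤ M) : c ^ (β - 1) ≤ a ^ (min β 1 - 1) * M ^ β := by
  rcases le_total β 1 with h | h
  · rw [min_eq_left h]
    have h1 := Real.rpow_le_rpow_of_nonpos ha hac (by linarith : β - 1 ≤ 0)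
    have h2 := Real.one_le_rpow hM hβ.le
    have h3 : 0 ≤ a ^ (β - 1) := by positivity
    nlinarith
  · rw [min_eq_right h, sub_self, Real.rpow_zero, one_mul]
    exact (Real.rpow_le_rpow (ha.le.trans hac) hcM (by linarith)).trans
      (Real.rpow_le_rpow_of_exponent_le hM (by linarith))

theorem abs_rpow_sub_rpow_le {β a b M : ℝ} (hβ : 0 < β) (ha : 0 < a) (hb : 0 ≤ b) (haM : a ≤ M)
    (hbM : b ≤ M) (hM : 1 ≤ M) :
    |b ^ β - a ^ β| ≤ max β 1 * |b - a| * a ^ (min β 1 - 1) * M ^ β := by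
  have hmax : 0 ≤ max β 1 := by positivity
  rcases le_total a b with h | h
  · have h1 := rpow_sub_rpow_le hβ ha.le h (ha.trans_le h)
    have h2 := rpow_sub_one_le hβ ha h hbM hM
    rw [abs_of_nonneg (sub_nonneg.2 (Real.rpow_le_rpow ha.le h hβ.le)),
      abs_of_nonneg (sub_nonneg.2 h)]
    have := mul_le_mul_of_nonneg_left h2 (mul_nonneg hmax (sub_nonneg.2 h))
    linarith
  · have h1 := rpow_sub_rpow_le hβ hb h ha
    have h2 := rpow_sub_one_le hβ ha le_rfl haM hM
    rw [abs_sub_comm, abs_sub_comm b, abs_of_nonneg (sub_nonneg.2 (Real.rpow_le_rpow hb h hβ.le)),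
      abs_of_nonneg (sub_nonneg.2 h)]
    have := mul_le_mul_of_nonneg_left h2 (mul_nonneg hmax (sub_nonneg.2 h))
    linarith

theorem abs_prod_sub_prod_le {ι : Type*} (s : Finset ι) {a b e M : ι → ℝ}
    (ha : ∀ i, |a i| ≤ M i) (hb : ∀ i, |b i| ≤ M i) (hab : ∀ i, |b i - a i| ≤ e i * M i) :
    |∏ i ∈ s, b i - ∏ i ∈ s, a i| ≤ (∑ i ∈ s, e i) * ∏ i ∈ s, M i := by
  classical
  induction s using Finset.induction_on with
  | empty => simp
  | insert i s hi ih =>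
    rw [prod_insert hi, prod_insert hi, prod_insert hi, sum_insert hi]
    have h1 : |∏ j ∈ s, a j| ≤ ∏ j ∈ s, M j := by
      rw [Finset.abs_prod]; exact prod_le_prod (fun _ _ => abs_nonneg _) fun j _ => ha j
    calc |b i * ∏ j ∈ s, b j - a i * ∏ j ∈ s, a j|
        = |b i * (∏ j ∈ s, b j - ∏ j ∈ s, a j) + (b i - a i) * ∏ j ∈ s, a j| := by ring_nf
      _ ≤ |b i| * |∏ j ∈ s, b j - ∏ j ∈ s, a j| + |b i - a i| * |∏ j ∈ s, a j| := by
          rw [← abs_mul, ← abs_mul]; exact abs_add_le _ _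
      _ ≤ M i * ((∑ j ∈ s, e j) * ∏ j ∈ s, M j) + e i * M i * ∏ j ∈ s, M j := by
          have := (abs_nonneg _).trans (hb i)
          have := (abs_nonneg _).trans (hab i)
          gcongr
          exacts [hb i, hab i]
      _ = _ := by ring

theorem abs_sub_le_mul_one_add_abs {x₀ x : ℝ} (hx : |x - x₀| ≤ 1) (y : ℝ) :
    |x - y| ≤ (|x₀| + 2) * (1 + |y|) := by
  have h1 := abs_sub x y
  have h2 := abs_sub_abs_le_abs_sub x x₀
  nlinarith [abs_nonneg x₀, abs_nonneg y]

theorem integrable_indicator_abs_sub_rpow {r : ℝ} (hr : -1 < r) (x : ℝ) :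
    Integrable ((Metric.closedBall x 1).indicator fun y => |x - y| ^ r) := by
  have h1 : IntervalIntegrable (fun y : ℝ => |y| ^ r) volume 0 1 := by
    refine (intervalIntegral.intervalIntegrable_rpow' hr).congr fun y hy => ?_
    rw [Set.uIoc_of_le zero_le_one] at hy
    simp only [abs_of_pos hy.1]
  have h2 : IntervalIntegrable (fun y : ℝ => |y| ^ r) volume (-1) 0 := by
    have := (IntervalIntegrable.iff_comp_neg).1 h1 |>.symm
    simpa using this
  have h3 : IntegrableOn (fun y : ℝ => |y| ^ r) (Set.Icc (-1) 1) := by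
    rw [integrableOn_Icc_iff_integrableOn_Ioc]
    exact (intervalIntegrable_iff_integrableOn_Ioc_of_le (by norm_num)).1 (h2.trans h1)
  have h4 := ((integrable_indicator_iff measurableSet_Icc).2 h3).comp_sub_left x
  refine h4.congr (.of_forall fun y => ?_)
  simp only [Set.indicator, Metric.mem_closedBall, Real.dist_eq, abs_sub_comm y x, abs_le,
    Set.mem_Icc]

/-! ### Differentiation under the integral sign -/

theorem integrable_rpow_mul_moment_weight1D {k : ℕ} {β m r : ℝ} {V : ℝ → ℝ} (hβ : 0 ≤ β)
    (hr : -1 < r) (hr0 : r ≤ 0) (hV : Continuous V) (x : ℝ)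
    (h : Integrable fun lam : Fin (k + 1) → ℝ =>
      (∏ j, (1 + |lam j|) ^ β) * weight1D (k + 1) β m V lam) (i : Fin (k + 1)) :
    Integrable fun lam : Fin (k + 1) → ℝ =>
      |x - lam i| ^ r * ((∏ j, (1 + |lam j|) ^ β) * weight1D (k + 1) β m V lam) := by
  suffices h0 : Integrable fun lam : Fin (k + 1) → ℝ =>
      |x - lam 0| ^ r * ((∏ j, (1 + |lam j|) ^ β) * weight1D (k + 1) β m V lam) by
    refine (((measurePreserving_comp_perm (Equiv.swap 0 i)).integrable_comp_emb
      (measurableEmbedding_comp_perm _)).2 h0).congr (.of_forall fun lam => ?_)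
    simp only [Function.comp_apply, weight1D_comp_perm, Equiv.swap_apply_left,
      Equiv.prod_comp (Equiv.swap 0 i) fun j => (1 + |lam j|) ^ β]
  have h2 := integrable_moment_weight1D hβ hV h
  obtain ⟨C, hC⟩ := (isCompact_closedBall x 1).exists_bound_of_continuousOn
    (f := fun y => (1 + |y|) ^ β * Real.exp (-m * V y))
    (Continuous.mul (Continuous.rpow_const (by fun_prop) fun y => .inl (by positivity))
      (by fun_prop)).continuousOn
  have hb := ((integrable_indicator_abs_sub_rpow hr x).const_mul
    (C * ((|x| + 2) ^ β) ^ k)).mul_prod h2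
  rw [← integrable_finCons_iff]
  refine ((integrable_finCons_iff.2 h).add hb).mono' ?_ (.of_forall fun ⟨y, lam⟩ => ?_)
  · refine AEStronglyMeasurable.mul ?_ (integrable_finCons_iff.2 h).aestronglyMeasurable
    simp only [Fin.cons_zero]
    exact Measurable.aestronglyMeasurable (by fun_prop)
  · have hw := weight1D_nonneg k β m V lam
    have hw' := weight1D_nonneg (k + 1) β m V (Fin.cons y lam)
    rw [Real.norm_of_nonneg (by positivity)]
    simp only [Pi.add_apply, Fin.cons_zero]
    by_cases hy : y ∈ Metric.closedBall x 1
    · refine le_add_of_nonneg_of_le (by positivity) ?_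
      have hyx : |y - x| ≤ 1 := by simpa [Real.dist_eq] using hy
      have hC' := (Real.le_norm_self _).trans (hC y hy)
      rw [Set.indicator_of_mem hy]
      simp only [weight1D_cons, Fin.prod_univ_succ, Fin.cons_zero, Fin.cons_succ]
      have hp : ∏ j, |y - lam j| ^ β ≤ ((|x| + 2) ^ β) ^ k * ∏ j, (1 + |lam j|) ^ β := by
        calc _ ≤ ∏ j, ((|x| + 2) ^ β * (1 + |lam j|) ^ β) := by
              gcongr with j
              rw [← Real.mul_rpow (by positivity) (by positivity)]
              gcongr
              exact abs_sub_le_mul_one_add_abs hyx _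
          _ = _ := by simp [Finset.prod_mul_distrib]
      have hpp : ∏ j, (1 + |lam j|) ^ (β + β) =
          (∏ j, (1 + |lam j|) ^ β) * ∏ j, (1 + |lam j|) ^ β := by
        rw [← Finset.prod_mul_distrib]
        exact Finset.prod_congr rfl fun j _ => Real.rpow_add (by positivity) _ _
      rw [hpp]
      calc _ = ((1 + |y|) ^ β * Real.exp (-m * V y)) * (∏ j, |y - lam j| ^ β) *
            (|x - y| ^ r * (∏ j, (1 + |lam j|) ^ β) * weight1D k β m V lam) := by ring
        _ ≤ C * (((|x| + 2) ^ β) ^ k * ∏ j, (1 + |lam j|) ^ β) *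
            (|x - y| ^ r * (∏ j, (1 + |lam j|) ^ β) * weight1D k β m V lam) := by
            gcongr
            exact le_trans (by positivity) hC'
        _ = _ := by ring
    · rw [Set.indicator_of_notMem hy]
      have hyx : 1 ≤ |x - y| := by
        rw [Metric.mem_closedBall, Real.dist_eq, not_le, abs_sub_comm] at hy
        exact hy.le
      simp only [mul_zero, zero_mul, add_zero]
      exact mul_le_of_le_one_left (by positivity) (Real.rpow_le_one_of_one_le_of_nonpos hyx hr0)

theorem hasDerivAt_abs_sub_rpow (β : ℝ) {x y : ℝ} (h : x ≠ y) :
    HasDerivAt (fun x => |x - y| ^ β) (β * (x - y)⁻¹ * |x - y| ^ β) x := by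
  have hne : x - y ≠ 0 := sub_ne_zero.2 h
  have h1 := ((hasDerivAt_abs hne).comp x ((hasDerivAt_id x).sub_const y)).rpow_const (p := β)
    (.inl (by simpa using hne))
  refine h1.congr_deriv ?_
  simp only [Function.comp_apply, id, mul_one]
  rw [Real.rpow_sub_one (abs_ne_zero.2 hne)]
  rcases hne.lt_or_gt with h0 | h0
  · rw [sign_neg h0, abs_of_neg h0]; simp; field_simp; ring
  · rw [sign_pos h0, abs_of_pos h0]; simp; field_simp

theorem hasDerivAt_prod_abs_sub_rpow {k : ℕ} (β : ℝ) {x : ℝ} {lam : Fin k → ℝ}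
    (h : ∀ j, lam j ≠ x) :
    HasDerivAt (fun x => ∏ j, |x - lam j| ^ β)
      (∑ j, β * (x - lam j)⁻¹ * ∏ l, |x - lam l| ^ β) x := by
  have := HasDerivAt.fun_finsetProd (u := univ) fun j _ => hasDerivAt_abs_sub_rpow β (h j).symm
  refine this.congr_deriv (Finset.sum_congr rfl fun j _ => ?_)
  rw [smul_eq_mul, ← Finset.mul_prod_erase univ (fun l => |x - lam l| ^ β) (Finset.mem_univ j)]
  ring

section DerivIntegral

variable {k : ℕ} {β m : ℝ} {V : ℝ → ℝ}

theorem continuous_prod_abs_sub_rpow (hβ : 0 ≤ β) (x : ℝ) :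
    Continuous fun lam : Fin k → ℝ => ∏ j, |x - lam j| ^ β :=
  continuous_finsetProd _ fun _ _ => Continuous.rpow_const (by fun_prop) fun _ => .inr hβ

theorem ae_forall_ne (k : ℕ) (x : ℝ) : ∀ᵐ lam : Fin k → ℝ, ∀ j, lam j ≠ x :=
  Filter.eventually_all.2 fun j => Measure.ae_eval_ne (fun _ : Fin k => (volume : Measure ℝ)) j x

theorem prod_mul_one_add_abs_rpow (β x : ℝ) (lam : Fin k → ℝ) :
    ∏ j, ((|x| + 2) * (1 + |lam j|)) ^ β = ((|x| + 2) ^ β) ^ k * ∏ j, (1 + |lam j|) ^ β := by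
  simp [Real.mul_rpow (show 0 ≤ |x| + 2 by positivity) (show 0 ≤ 1 + |lam _| by positivity),
    Finset.prod_mul_distrib]

theorem integrable_inv_sub_mul_weight1D (hβ : 0 < β) (hV : Continuous V)
    (h : Integrable fun lam : Fin (k + 1) → ℝ =>
      (∏ j, (1 + |lam j|) ^ β) * weight1D (k + 1) β m V lam) (x : ℝ) (i : Fin (k + 1)) :
    Integrable fun lam : Fin (k + 1) → ℝ =>
      (x - lam i)⁻¹ * ((∏ j, |x - lam j| ^ β) * weight1D (k + 1) β m V lam) := by
  have hb := (integrable_rpow_mul_moment_weight1D hβ.le (r := min β 1 - 1)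
    (by linarith [lt_min hβ one_pos]) (by linarith [min_le_right β 1]) hV x h i).const_mul
    (((|x| + 2) ^ β) ^ (k + 1))
  refine hb.mono' ?_ ?_
  · refine AEStronglyMeasurable.mul (Measurable.aestronglyMeasurable (by fun_prop)) ?_
    exact ((continuous_prod_abs_sub_rpow hβ.le x).mul
      (continuous_weight1D _ hβ.le m hV)).aestronglyMeasurable
  · filter_upwards [ae_forall_ne (k + 1) x] with lam hlam
    have hw := weight1D_nonneg (k + 1) β m V lam
    have hpos : 0 < |x - lam i| := abs_pos.2 (sub_ne_zero.2 (hlam i).symm)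
    have hx : |x - x| ≤ 1 := by simp
    rw [norm_mul, norm_inv, Real.norm_eq_abs, Real.norm_of_nonneg (by positivity)]
    have hi : |x - lam i|⁻¹ * |x - lam i| ^ β ≤
        |x - lam i| ^ (min β 1 - 1) * ((|x| + 2) * (1 + |lam i|)) ^ β := by
      rw [← Real.rpow_neg_one, ← Real.rpow_add hpos, neg_add_eq_sub]
      exact rpow_sub_one_le hβ hpos le_rfl (abs_sub_le_mul_one_add_abs hx _)
        (by nlinarith [abs_nonneg x, abs_nonneg (lam i)])
    calc _ = (|x - lam i|⁻¹ * |x - lam i| ^ β) * (∏ j ∈ univ.erase i, |x - lam j| ^ β) *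
          weight1D (k + 1) β m V lam := by
          rw [← Finset.mul_prod_erase univ (fun l => |x - lam l| ^ β) (Finset.mem_univ i)]; ring
      _ ≤ (|x - lam i| ^ (min β 1 - 1) * ((|x| + 2) * (1 + |lam i|)) ^ β) *
          (∏ j ∈ univ.erase i, ((|x| + 2) * (1 + |lam j|)) ^ β) *
          weight1D (k + 1) β m V lam := by
          gcongr with j
          exact abs_sub_le_mul_one_add_abs hx _
      _ = |x - lam i| ^ (min β 1 - 1) * ((∏ j, ((|x| + 2) * (1 + |lam j|)) ^ β) *
          weight1D (k + 1) β m V lam) := by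
          rw [← Finset.mul_prod_erase univ (fun l => ((|x| + 2) * (1 + |lam l|)) ^ β)
            (Finset.mem_univ i)]
          ring
      _ = _ := by rw [prod_mul_one_add_abs_rpow]; ring

theorem hasDerivAt_integral_prod_mul_weight1D (hβ : 0 < β) (hV : Continuous V)
    (h : Integrable fun lam : Fin (k + 1) → ℝ =>
      (∏ j, (1 + |lam j|) ^ β) * weight1D (k + 1) β m V lam) (x : ℝ) :
    HasDerivAt (fun x => ∫ lam : Fin (k + 1) → ℝ,
        (∏ j, |x - lam j| ^ β) * weight1D (k + 1) β m V lam)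
      (∫ lam : Fin (k + 1) → ℝ,
        ∑ i, β * ((x - lam i)⁻¹ * ((∏ j, |x - lam j| ^ β) * weight1D (k + 1) β m V lam))) x := by
  have hmeas : ∀ y, AEStronglyMeasurable fun lam : Fin (k + 1) → ℝ =>
      (∏ j, |y - lam j| ^ β) * weight1D (k + 1) β m V lam := fun y =>
    ((continuous_prod_abs_sub_rpow hβ.le y).mul
      (continuous_weight1D _ hβ.le m hV)).aestronglyMeasurable
  have hint : Integrable fun lam : Fin (k + 1) → ℝ =>
      ∑ i, β * ((x - lam i)⁻¹ * ((∏ j, |x - lam j| ^ β) * weight1D (k + 1) β m V lam)) :=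
    integrable_finsetSum _ fun i _ => (integrable_inv_sub_mul_weight1D hβ hV h x i).const_mul β
  have hb : Integrable fun lam : Fin (k + 1) → ℝ => (max β 1 * ((|x| + 2) ^ β) ^ (k + 1)) *
      ∑ i, |x - lam i| ^ (min β 1 - 1) *
        ((∏ j, (1 + |lam j|) ^ β) * weight1D (k + 1) β m V lam) :=
    (integrable_finsetSum _ fun i _ => integrable_rpow_mul_moment_weight1D hβ.le
      (by linarith [lt_min hβ one_pos]) (by linarith [min_le_right β 1]) hV x h i).const_mul _
  have hx : |x - x| ≤ 1 := by simp
  rw [hasDerivAt_iff_hasFDerivAt]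
  have key := hasFDerivAt_integral_of_dominated_loc_of_lip' (𝕜 := ℝ) (x₀ := x)
    (F := fun x (lam : Fin (k + 1) → ℝ) => (∏ j, |x - lam j| ^ β) * weight1D (k + 1) β m V lam)
    (F' := fun lam : Fin (k + 1) → ℝ => ContinuousLinearMap.toSpanSingleton ℝ
      (∑ i, β * ((x - lam i)⁻¹ * ((∏ j, |x - lam j| ^ β) * weight1D (k + 1) β m V lam))))
    (Metric.ball_mem_nhds x one_pos) (fun y _ => hmeas y) ?_ ?_ ?_ hb ?_
  · refine key.2.congr_fderiv ?_
    ext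
    rw [ContinuousLinearMap.integral_apply key.1]
    simp
  · refine (h.const_mul (((|x| + 2) ^ β) ^ (k + 1))).mono' (hmeas x) (.of_forall fun lam => ?_)
    have hw := weight1D_nonneg (k + 1) β m V lam
    rw [Real.norm_of_nonneg (by positivity), ← mul_assoc, ← prod_mul_one_add_abs_rpow]
    gcongr with j
    exact abs_sub_le_mul_one_add_abs hx _
  · exact ContinuousLinearMap.toSpanSingletonCLE.continuous.comp_aestronglyMeasurable
      hint.aestronglyMeasurable
  · filter_upwards [ae_forall_ne (k + 1) x] with lam hlam y hy
    have hyx : |y - x| ≤ 1 := by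
      rw [Metric.mem_ball, Real.dist_eq] at hy; exact hy.le
    have hw := weight1D_nonneg (k + 1) β m V lam
    have hp := abs_prod_sub_prod_le univ (a := fun j => |x - lam j| ^ β)
      (b := fun j => |y - lam j| ^ β) (e := fun j => max β 1 * |y - x| *
        |x - lam j| ^ (min β 1 - 1)) (M := fun j => ((|x| + 2) * (1 + |lam j|)) ^ β) ?_ ?_ ?_
    · rw [← sub_mul, norm_mul, Real.norm_of_nonneg hw, Real.norm_eq_abs, Real.norm_eq_abs]
      refine (mul_le_mul_of_nonneg_right hp hw).trans_eq ?_
      rw [prod_mul_one_add_abs_rpow, ← Finset.mul_sum, ← Finset.sum_mul]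
      ring
    · intro j
      rw [abs_of_nonneg (by positivity)]
      gcongr
      exact abs_sub_le_mul_one_add_abs hx _
    · intro j
      rw [abs_of_nonneg (by positivity)]
      gcongr
      exact abs_sub_le_mul_one_add_abs hyx _
    · intro j
      refine (abs_rpow_sub_rpow_le hβ (abs_pos.2 (sub_ne_zero.2 (hlam j).symm)) (abs_nonneg _)
        (abs_sub_le_mul_one_add_abs hx _) (abs_sub_le_mul_one_add_abs hyx _)
        (by nlinarith [abs_nonneg x, abs_nonneg (lam j)])).trans ?_
      have habs : |(|y - lam j| - |x - lam j|)| ≤ |y - x| := by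
        simpa using abs_abs_sub_abs_le (y - lam j) (x - lam j)
      gcongr
  · filter_upwards [ae_forall_ne (k + 1) x] with lam hlam
    rw [← hasDerivAt_iff_hasFDerivAt]
    refine ((hasDerivAt_prod_abs_sub_rpow β hlam).mul_const _).congr_deriv ?_
    rw [Finset.sum_mul]
    exact Finset.sum_congr rfl fun i _ => by ring

theorem integral_inv_sub_mul_weight1D_eq (x : ℝ) (i : Fin (k + 1)) :
    ∫ lam : Fin (k + 1) → ℝ,
        (x - lam i)⁻¹ * ((∏ j, |x - lam j| ^ β) * weight1D (k + 1) β m V lam) =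
      ∫ lam : Fin (k + 1) → ℝ,
        (x - lam 0)⁻¹ * ((∏ j, |x - lam j| ^ β) * weight1D (k + 1) β m V lam) := by
  refine Eq.trans (integral_congr_ae (.of_forall fun lam => ?_))
    ((measurePreserving_comp_perm (Equiv.swap 0 i)).integral_comp
      (measurableEmbedding_comp_perm _) _)
  simp only [Function.comp_apply, weight1D_comp_perm, Equiv.swap_apply_left,
    Equiv.prod_comp (Equiv.swap 0 i) fun j => |x - lam j| ^ β]

end DerivIntegral

/-- **Loop equation / Ward identity in 1D** (Proposition 2 of Akemann–Byun):
for a `C²`-smooth potential `V` growing faster than `log|λ|` at infinity, with finite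
partition function, at every point `λ` where `R_{N,1}` is differentiable and the integral
converges absolutely,
`β ∫ R_{N,2}(λ,λ')/(λ-λ') dλ' = m V'(λ) R_{N,1}(λ) + R_{N,1}'(λ)`. -/
theorem loop_equation_1D (n : ℕ) (β m : ℝ) (hβ : 0 < β) (hm : 0 < m)
    (V : ℝ → ℝ) (hV : ContDiff ℝ 2 V)
    (hgrowth : Filter.Tendsto (fun x : ℝ => V x - Real.log |x|) (Filter.atTop ⊔ Filter.atBot)
      Filter.atTop)
    (hZ : Integrable (weight1D (n + 2) β m V))
    (x : ℝ)
    (hR1 : DifferentiableAt ℝ (R1' n β m V) x)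
    (hconv : Integrable (fun y : ℝ => R2' n β m V x y / (x - y))) :
    β * ∫ y : ℝ, R2' n β m V x y / (x - y)
      = m * deriv V x * R1' n β m V x + deriv (R1' n β m V) x := by
  have hVc := hV.continuous
  have hmom : Integrable fun lam : Fin (n + 1) → ℝ =>
      (∏ j, (1 + |lam j|) ^ β) * weight1D (n + 1) β m V lam := by
    simpa using integrable_moment_weight1D (p := 0) hβ.le hVc (by simpa using hZ)
  set F : ℝ → ℝ := fun x => ∫ lam : Fin (n + 1) → ℝ,
    (∏ j, |x - lam j| ^ β) * weight1D (n + 1) β m V lam with hF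
  set G : ℝ := ∫ lam : Fin (n + 1) → ℝ,
    (x - lam 0)⁻¹ * ((∏ j, |x - lam j| ^ β) * weight1D (n + 1) β m V lam) with hG
  have hFG : HasDerivAt F ((n + 1) * (β * G)) x := by
    refine (hasDerivAt_integral_prod_mul_weight1D hβ hVc hmom x).congr_deriv ?_
    rw [integral_finsetSum _ fun i _ =>
      (integrable_inv_sub_mul_weight1D hβ hVc hmom x i).const_mul β]
    simp only [integral_const_mul, integral_inv_sub_mul_weight1D_eq, ← hG]
    simp
  have hR1F : R1' n β m V = fun y =>
      (n + 2) * (Z1D (n + 2) β m V)⁻¹ * (Real.exp (-m * V y) * F y) := by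
    ext y
    simp only [R1', p1D, weight1D_cons, integral_const_mul, hF]
    ring
  have hR2G : ∫ y : ℝ, R2' n β m V x y / (x - y) =
      (n + 2) * (n + 1) * (Z1D (n + 2) β m V)⁻¹ * Real.exp (-m * V x) * G := by
    rw [hG, ← integral_finCons (integrable_inv_sub_mul_weight1D hβ hVc hmom x 0),
      ← integral_const_mul]
    refine integral_congr_ae (.of_forall fun y => ?_)
    simp only [R2', p1D, weight1D_cons (n + 1), integral_const_mul, Fin.cons_zero]
    ring
  have hexp : HasDerivAt (fun y => Real.exp (-m * V y))
      (Real.exp (-m * V x) * (-m * deriv V x)) x :=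
    (((hV.differentiable (by norm_num)) x).hasDerivAt.const_mul (-m)).exp
  rw [hR2G, hR1F, ((hexp.fun_mul hFG).const_mul _).deriv]
  beta_reduce
  ring
end

section
/- Let N ≥ 2, β > 0, m > 0, and let V : ℝ → ℝ be a C²-smooth potential growing faster than log|λ| at infinity so that the Gibbs measure with density p_N(λ₁,…,λ_N) = Z_N^{−1} ∏_{j>k} |λ_j − λ_k|^β exp(−m Σ_j V(λ_j)) is a well-defined probability measure on ℝ^N. For any test function ψ ∈ C_c^∞(ℝ), define Ŵ_N^+[ψ](λ) = 2β · (1/4) Σ_{j≠k} (ψ(λ_j) − ψ(λ_k))/(λ_j − λ_k) − m Σ_j V'(λ_j) ψ(λ_j) + Σ_j ψ'(λ_j). Then the expectation of Ŵ_N^+[ψ] with respect to the Gibbs measure vanishes: E_N Ŵ_N^+[ψ] = 0. -/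
open MeasureTheory Finset

/-- Ward's stress-energy functional `Ŵ_N^+[ψ]` for the 1D log-gas. -/
noncomputable def ward1D (N : ℕ) (β m : ℝ) (V : ℝ → ℝ) (ψ : ℝ → ℝ) (lam : Fin N → ℝ) : ℝ :=
  2 * β * ((1 / 4 : ℝ) * ∑ j : Fin N, ∑ k ∈ Finset.univ.filter (fun k => k ≠ j),
      (ψ (lam j) - ψ (lam k)) / (lam j - lam k))
    - m * ∑ j : Fin N, deriv V (lam j) * ψ (lam j)
    + ∑ j : Fin N, deriv ψ (lam j)

/-- The logarithm of the ratio between the Gibbs weight pulled back along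
`lam ↦ lam + ε ψ(lam)`, Jacobian included, and the Gibbs weight itself. -/
noncomputable def flowExponent (N : ℕ) (β m : ℝ) (V ψ : ℝ → ℝ) (ε : ℝ) (lam : Fin N → ℝ) : ℝ :=
  β * ∑ j : Fin N, ∑ k ∈ Finset.univ.filter (fun k => k < j),
      Real.log (1 + ε * ((ψ (lam j) - ψ (lam k)) / (lam j - lam k)))
    - m * ∑ j : Fin N, (V (lam j + ε * ψ (lam j)) - V (lam j))
    + ∑ j : Fin N, Real.log (1 + ε * deriv ψ (lam j))

/-- The derivative of `flowExponent` with respect to `ε`. -/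
noncomputable def flowExponentDeriv (N : ℕ) (β m : ℝ) (V ψ : ℝ → ℝ) (ε : ℝ)
    (lam : Fin N → ℝ) : ℝ :=
  β * ∑ j : Fin N, ∑ k ∈ Finset.univ.filter (fun k => k < j),
      (ψ (lam j) - ψ (lam k)) / (lam j - lam k) /
        (1 + ε * ((ψ (lam j) - ψ (lam k)) / (lam j - lam k)))
    - m * ∑ j : Fin N, deriv V (lam j + ε * ψ (lam j)) * ψ (lam j)
    + ∑ j : Fin N, deriv ψ (lam j) / (1 + ε * deriv ψ (lam j))

theorem sum_sum_ne_eq_two_mul_sum_sum_lt {ι : Type*} [Fintype ι] [LinearOrder ι]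
    (q : ι → ι → ℝ) (hq : ∀ j k, q j k = q k j) :
    ∑ j, ∑ k ∈ Finset.univ.filter (fun k => k ≠ j), q j k =
      2 * ∑ j, ∑ k ∈ Finset.univ.filter (fun k => k < j), q j k := by
  have hswap : ∑ j, ∑ k ∈ Finset.univ.filter (fun k => j < k), q j k =
      ∑ j, ∑ k ∈ Finset.univ.filter (fun k => k < j), q j k := by
    rw [Finset.sum_comm' (t' := Finset.univ)
      (s' := fun k => Finset.univ.filter (fun j => j < k)) (by simp)]
    exact Finset.sum_congr rfl fun j _ => Finset.sum_congr rfl fun k _ => hq k j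
  have hsplit : ∀ j, ∑ k ∈ Finset.univ.filter (fun k => k ≠ j), q j k =
      ∑ k ∈ Finset.univ.filter (fun k => k < j), q j k +
        ∑ k ∈ Finset.univ.filter (fun k => j < k), q j k := by
    intro j
    rw [← Finset.sum_union]
    · congr 1
      ext k
      simp
    · rw [Finset.disjoint_filter]
      exact fun k _ h => h.not_gt
  simp_rw [hsplit, Finset.sum_add_distrib, hswap]
  ring

theorem flowExponentDeriv_zero (N : ℕ) (β m : ℝ) (V ψ : ℝ → ℝ) (lam : Fin N → ℝ) :
    flowExponentDeriv N β m V ψ 0 lam = ward1D N β m V ψ lam := by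
  unfold flowExponentDeriv ward1D
  rw [sum_sum_ne_eq_two_mul_sum_sum_lt
    (fun j k => (ψ (lam j) - ψ (lam k)) / (lam j - lam k))]
  · simp only [zero_mul, add_zero, div_one]
    ring
  · intro j k
    rw [← neg_sub (ψ (lam k)), ← neg_sub (lam k), neg_div_neg_eq]

theorem flowExponent_zero (N : ℕ) (β m : ℝ) (V ψ : ℝ → ℝ) (lam : Fin N → ℝ) :
    flowExponent N β m V ψ 0 lam = 0 := by
  simp [flowExponent]

theorem measurable_flowExponent (N : ℕ) (β m : ℝ) {V ψ : ℝ → ℝ} (hV : Measurable V)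
    (hψ : Measurable ψ) (ε : ℝ) : Measurable (flowExponent N β m V ψ ε) := by
  have := measurable_deriv ψ
  unfold flowExponent
  fun_prop

theorem measurable_flowExponentDeriv (N : ℕ) (β m : ℝ) (V : ℝ → ℝ) {ψ : ℝ → ℝ}
    (hψ : Measurable ψ) (ε : ℝ) : Measurable (flowExponentDeriv N β m V ψ ε) := by
  have := measurable_deriv ψ
  have := measurable_deriv V
  unfold flowExponentDeriv
  fun_prop

theorem half_le_one_add_mul {L ε q : ℝ} (hε : |ε| * L ≤ 1 / 2) (hq : |q| ≤ L) :
    1 / 2 ≤ 1 + ε * q := by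
  have h : |ε * q| ≤ 1 / 2 := by
    rw [abs_mul]
    exact (mul_le_mul_of_nonneg_left hq (abs_nonneg ε)).trans hε
  linarith [(abs_le.mp h).1]

theorem abs_div_one_add_mul_le {L ε q : ℝ} (hε : |ε| * L ≤ 1 / 2) (hq : |q| ≤ L) :
    |q / (1 + ε * q)| ≤ 2 * L := by
  have h := half_le_one_add_mul hε hq
  rw [abs_div, abs_of_pos (by linarith : 0 < 1 + ε * q), div_le_iff₀ (by linarith)]
  nlinarith [abs_nonneg q]

theorem hasDerivAt_flowExponent (N : ℕ) (β m : ℝ) {V ψ : ℝ → ℝ} {L ε : ℝ}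
    (hV : Differentiable ℝ V) (hq : ∀ x y, |(ψ x - ψ y) / (x - y)| ≤ L)
    (hψ' : ∀ x, |deriv ψ x| ≤ L) (hε : |ε| * L ≤ 1 / 2) (lam : Fin N → ℝ) :
    HasDerivAt (fun ε => flowExponent N β m V ψ ε lam)
      (flowExponentDeriv N β m V ψ ε lam) ε := by
  have hlog : ∀ q : ℝ, |q| ≤ L →
      HasDerivAt (fun ε => Real.log (1 + ε * q)) (q / (1 + ε * q)) ε := by
    intro q hqL
    have h := half_le_one_add_mul hε hqL
    have h1 : HasDerivAt (fun ε : ℝ => 1 + ε * q) q ε := by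
      simpa using ((hasDerivAt_id ε).mul_const q).const_add 1
    exact h1.log (by linarith)
  unfold flowExponent flowExponentDeriv
  refine ((HasDerivAt.const_mul β ?_).sub (HasDerivAt.const_mul m ?_)).add ?_
  · exact HasDerivAt.fun_sum fun j _ => HasDerivAt.fun_sum fun k _ => hlog _ (hq _ _)
  · refine HasDerivAt.fun_sum fun j _ => ?_
    have h1 : HasDerivAt (fun ε : ℝ => lam j + ε * ψ (lam j)) (ψ (lam j)) ε := by
      simpa using ((hasDerivAt_id ε).mul_const (ψ (lam j))).const_add (lam j)
    exact ((hV _).hasDerivAt.comp ε h1).sub_const _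
  · exact HasDerivAt.fun_sum fun j _ => hlog _ (hψ' _)

theorem abs_flowExponentDeriv_le (N : ℕ) (β m : ℝ) {V ψ : ℝ → ℝ} {L K ε : ℝ}
    (hq : ∀ x y, |(ψ x - ψ y) / (x - y)| ≤ L) (hψ' : ∀ x, |deriv ψ x| ≤ L)
    (hε : |ε| * L ≤ 1 / 2) (hK : ∀ x, |deriv V (x + ε * ψ x) * ψ x| ≤ K)
    (lam : Fin N → ℝ) :
    |flowExponentDeriv N β m V ψ ε lam| ≤
      |β| * ∑ j : Fin N, ∑ _k ∈ Finset.univ.filter (fun k => k < j), 2 * L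
        + |m| * ∑ _j : Fin N, K + ∑ _j : Fin N, 2 * L := by
  unfold flowExponentDeriv
  refine (abs_add_le _ _).trans (add_le_add ((abs_sub _ _).trans (add_le_add ?_ ?_)) ?_)
  · rw [abs_mul]
    gcongr
    exact (Finset.abs_sum_le_sum_abs _ _).trans <| Finset.sum_le_sum fun j _ =>
      (Finset.abs_sum_le_sum_abs _ _).trans <| Finset.sum_le_sum fun k _ =>
        abs_div_one_add_mul_le hε (hq _ _)
  · rw [abs_mul]
    gcongr
    exact (Finset.abs_sum_le_sum_abs _ _).trans <| Finset.sum_le_sum fun j _ => hK _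
  · exact (Finset.abs_sum_le_sum_abs _ _).trans <| Finset.sum_le_sum fun j _ =>
      abs_div_one_add_mul_le hε (hψ' _)

theorem prod_mul_weight1D_flow (N : ℕ) (β m : ℝ) (V : ℝ → ℝ) {ψ : ℝ → ℝ} {L ε : ℝ}
    (hq : ∀ x y, |(ψ x - ψ y) / (x - y)| ≤ L) (hψ' : ∀ x, |deriv ψ x| ≤ L)
    (hε : |ε| * L ≤ 1 / 2) (lam : Fin N → ℝ) :
    (∏ j, (1 + ε * deriv ψ (lam j))) * weight1D N β m V (fun j => lam j + ε * ψ (lam j)) =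
      weight1D N β m V lam * Real.exp (flowExponent N β m V ψ ε lam) := by
  have hpos : ∀ q : ℝ, |q| ≤ L → 0 < 1 + ε * q := fun q h => by
    linarith [half_le_one_add_mul hε h]
  have hpair : ∀ x y : ℝ, |(x + ε * ψ x) - (y + ε * ψ y)| ^ β =
      |x - y| ^ β * Real.exp (β * Real.log (1 + ε * ((ψ x - ψ y) / (x - y)))) := by
    intro x y
    have hp := hpos _ (hq x y)
    rw [mul_comm β, ← Real.rpow_def_of_pos hp, ← Real.mul_rpow (abs_nonneg _) hp.le]
    congr 1
    rw [← abs_of_pos hp, ← abs_mul]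
    congr 1
    rcases eq_or_ne x y with rfl | h
    · simp
    · have := sub_ne_zero.mpr h
      field_simp
      ring
  have hjac : ∏ j, (1 + ε * deriv ψ (lam j)) =
      Real.exp (∑ j, Real.log (1 + ε * deriv ψ (lam j))) := by
    rw [Real.exp_sum]
    exact Finset.prod_congr rfl fun j _ => (Real.exp_log (hpos _ (hψ' _))).symm
  unfold weight1D flowExponent
  simp_rw [hpair, Finset.prod_mul_distrib, ← Real.exp_sum, ← Finset.mul_sum]
  rw [hjac, mul_comm, mul_assoc, mul_assoc, mul_assoc, ← Real.exp_add, ← Real.exp_add,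
    ← Real.exp_add, Finset.sum_sub_distrib]
  congr 2
  ring

/-- Change of variables for a map acting as the same function on every coordinate. -/
theorem integral_prod_abs_deriv_mul_comp_coordinatewise {ι : Type*} [Fintype ι]
    {t t' : ℝ → ℝ} (ht : ∀ x, HasDerivAt t (t' x) x) (hbij : Function.Bijective t)
    (g : (ι → ℝ) → ℝ) :
    ∫ x : ι → ℝ, |∏ j, t' (x j)| * g (fun j => t (x j)) = ∫ x : ι → ℝ, g x := by
  classical
  let A : (ι → ℝ) → (ι → ℝ) →L[ℝ] (ι → ℝ) := fun x =>
    ContinuousLinearMap.pi fun j => t' (x j) • ContinuousLinearMap.proj j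
  have hdet : ∀ x, (A x).det = ∏ j, t' (x j) := by
    intro x
    have hA : ((A x : (ι → ℝ) →L[ℝ] (ι → ℝ)) : (ι → ℝ) →ₗ[ℝ] (ι → ℝ)) =
        Matrix.toLin' (Matrix.diagonal fun j => t' (x j)) := by
      ext1 j
      ext k
      simp [A, Matrix.mulVec_diagonal]
    rw [ContinuousLinearMap.det, hA, LinearMap.det_toLin', Matrix.det_diagonal]
  have hderiv : ∀ x ∈ (Set.univ : Set (ι → ℝ)),
      HasFDerivWithinAt (fun (y : ι → ℝ) j => t (y j)) (A x) Set.univ x := by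
    intro x _
    refine HasFDerivAt.hasFDerivWithinAt (hasFDerivAt_pi.mpr fun j => ?_)
    exact (ht (x j)).comp_hasFDerivAt x (hasFDerivAt_apply j x)
  have hinj : Set.InjOn (fun (y : ι → ℝ) j => t (y j)) Set.univ := fun x _ y _ h =>
    funext fun j => hbij.1 (congrFun h j)
  have himage : (fun (y : ι → ℝ) j => t (y j)) '' Set.univ = Set.univ := by
    rw [Set.image_univ, Set.range_eq_univ]
    intro y
    choose x hx using fun j => hbij.2 (y j)
    exact ⟨x, funext hx⟩
  have h := integral_image_eq_integral_abs_det_fderiv_smul volume MeasurableSet.univ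
    hderiv hinj g
  rw [himage, setIntegral_univ, setIntegral_univ] at h
  simpa only [hdet, smul_eq_mul] using h.symm

theorem bijective_add_const_mul {ψ : ℝ → ℝ} {L M ε : ℝ} (hψ : Differentiable ℝ ψ)
    (hψ' : ∀ x, |deriv ψ x| ≤ L) (hM : ∀ x, |ψ x| ≤ M) (hε : |ε| * L ≤ 1 / 2) :
    Function.Bijective fun x => x + ε * ψ x := by
  have hbound : ∀ x, |ε * ψ x| ≤ |ε| * M := fun x => by
    rw [abs_mul]
    exact mul_le_mul_of_nonneg_left (hM x) (abs_nonneg ε)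
  have hd : ∀ x, HasDerivAt (fun x => x + ε * ψ x) (1 + ε * deriv ψ x) x := fun x =>
    (hasDerivAt_id x).add ((hψ x).hasDerivAt.const_mul ε)
  refine ⟨(strictMono_of_deriv_pos fun x => ?_).injective, Continuous.surjective ?_ ?_ ?_⟩
  · rw [(hd x).deriv]
    linarith [half_le_one_add_mul hε (hψ' x)]
  · exact continuous_iff_continuousAt.mpr fun x => (hd x).continuousAt
  · exact Filter.tendsto_atTop_add_right_of_le _ (-(|ε| * M)) Filter.tendsto_id
      fun x => (abs_le.mp (hbound x)).1
  · exact Filter.tendsto_atBot_add_right_of_ge _ (|ε| * M) Filter.tendsto_id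
      fun x => (abs_le.mp (hbound x)).2

theorem exists_abs_deriv_comp_flow_mul_le {V ψ : ℝ → ℝ} (hV : Continuous (deriv V))
    (hψ : Continuous ψ) (hψc : HasCompactSupport ψ) :
    ∃ K, ∀ ε, |ε| ≤ 1 → ∀ x, |deriv V (x + ε * ψ x) * ψ x| ≤ K := by
  have hc : Continuous fun p : ℝ × ℝ => deriv V (p.2 + p.1 * ψ p.2) * ψ p.2 := by fun_prop
  obtain ⟨K, hK⟩ := ((isCompact_Icc (a := (-1 : ℝ)) (b := 1)).prod hψc).exists_bound_of_continuousOn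
    hc.continuousOn
  refine ⟨max K 0, fun ε hε x => ?_⟩
  by_cases hx : x ∈ tsupport ψ
  · exact (hK (ε, x) ⟨abs_le.mp hε, hx⟩).trans (le_max_left _ _)
  · simp [image_eq_zero_of_notMem_tsupport hx]

theorem integral_weight1D_mul_ward1D (N : ℕ) (β m : ℝ) {V ψ : ℝ → ℝ} (hV : ContDiff ℝ 1 V)
    (hZ : Integrable (weight1D N β m V)) (hψ : ContDiff ℝ 1 ψ) (hψc : HasCompactSupport ψ) :
    ∫ lam : Fin N → ℝ, weight1D N β m V lam * ward1D N β m V ψ lam = 0 := by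
  have hψd : Differentiable ℝ ψ := hψ.differentiable one_ne_zero
  have hVd : Differentiable ℝ V := hV.differentiable one_ne_zero
  obtain ⟨M, hM⟩ := hψc.exists_bound_of_continuous hψ.continuous
  obtain ⟨L, hL⟩ := hψc.deriv.exists_bound_of_continuous (hψ.continuous_deriv le_rfl)
  simp only [Real.norm_eq_abs] at hM hL
  have hL0 : 0 ≤ L := (abs_nonneg _).trans (hL 0)
  have hq : ∀ x y, |(ψ x - ψ y) / (x - y)| ≤ L := by
    intro x y
    rw [abs_div]
    refine div_le_of_le_mul₀ (abs_nonneg _) hL0 ?_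
    exact convex_univ.norm_image_sub_le_of_norm_deriv_le (fun z _ => hψd z)
      (fun z _ => hL z) (Set.mem_univ y) (Set.mem_univ x)
  obtain ⟨K, hK⟩ := exists_abs_deriv_comp_flow_mul_le (hV.continuous_deriv le_rfl)
    hψ.continuous hψc
  set δ : ℝ := 1 / (2 * (L + 1)) with hδ
  have hδ0 : 0 < δ := by positivity
  have hδ1 : δ ≤ 1 := by
    rw [hδ, div_le_one (by positivity)]
    linarith
  have hδL : δ * L ≤ 1 / 2 := by
    rw [hδ, div_mul_eq_mul_div, div_le_div_iff₀ (by positivity) two_pos]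
    linarith
  have hball : ∀ ε ∈ Metric.ball (0 : ℝ) δ, |ε| ≤ 1 ∧ |ε| * L ≤ 1 / 2 := by
    intro ε hε
    rw [mem_ball_zero_iff, Real.norm_eq_abs] at hε
    exact ⟨hε.le.trans hδ1, (mul_le_mul_of_nonneg_right hε.le hL0).trans hδL⟩
  obtain ⟨C, hC⟩ : ∃ C, ∀ ε ∈ Metric.ball (0 : ℝ) δ, ∀ lam : Fin N → ℝ,
      |flowExponentDeriv N β m V ψ ε lam| ≤ C :=
    ⟨_, fun ε hε lam =>
      abs_flowExponentDeriv_le N β m hq hL (hball ε hε).2 (hK ε (hball ε hε).1) lam⟩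
  have hC0 : 0 ≤ C := (abs_nonneg _).trans (hC 0 (Metric.mem_ball_self hδ0) 0)
  have hderiv : ∀ ε ∈ Metric.ball (0 : ℝ) δ, ∀ lam : Fin N → ℝ,
      HasDerivAt (fun ε => flowExponent N β m V ψ ε lam)
        (flowExponentDeriv N β m V ψ ε lam) ε := fun ε hε lam =>
    hasDerivAt_flowExponent N β m hVd hq hL (hball ε hε).2 lam
  have hexponent : ∀ ε ∈ Metric.ball (0 : ℝ) δ, ∀ lam : Fin N → ℝ,
      flowExponent N β m V ψ ε lam ≤ C := by
    intro ε hε lam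
    have h := (convex_ball (0 : ℝ) δ).norm_image_sub_le_of_norm_hasDerivWithin_le
      (fun ε hε => (hderiv ε hε lam).hasDerivWithinAt) (fun ε hε => hC ε hε lam)
      (Metric.mem_ball_self hδ0) hε
    rw [flowExponent_zero, sub_zero, sub_zero, Real.norm_eq_abs, Real.norm_eq_abs] at h
    exact (le_abs_self _).trans (h.trans (mul_le_of_le_one_right hC0 (hball ε hε).1))
  have hconst : ∀ ε ∈ Metric.ball (0 : ℝ) δ,
      ∫ lam : Fin N → ℝ, weight1D N β m V lam * Real.exp (flowExponent N β m V ψ ε lam) =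
        ∫ lam : Fin N → ℝ, weight1D N β m V lam := by
    intro ε hε
    have hεL := (hball ε hε).2
    rw [← integral_prod_abs_deriv_mul_comp_coordinatewise
      (fun x => (hasDerivAt_id x).add ((hψd x).hasDerivAt.const_mul ε))
      (bijective_add_const_mul hψd hL hM hεL) (weight1D N β m V)]
    refine integral_congr_ae (Filter.Eventually.of_forall fun lam => ?_)
    have hpos : 0 ≤ ∏ j, (1 + ε * deriv ψ (lam j)) :=
      Finset.prod_nonneg fun j _ => by linarith [half_le_one_add_mul hεL (hL (lam j))]
    simp only [abs_of_nonneg hpos]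
    exact (prod_mul_weight1D_flow N β m V hq hL hεL lam).symm
  have hmain := (hasDerivAt_integral_of_dominated_loc_of_deriv_le
    (F := fun ε lam => weight1D N β m V lam * Real.exp (flowExponent N β m V ψ ε lam))
    (F' := fun ε lam => weight1D N β m V lam *
      (Real.exp (flowExponent N β m V ψ ε lam) * flowExponentDeriv N β m V ψ ε lam))
    (bound := fun lam => |weight1D N β m V lam| * (Real.exp C * C)) (μ := volume) (x₀ := 0)
    (Metric.ball_mem_nhds (0 : ℝ) hδ0)
    (Filter.Eventually.of_forall fun ε => hZ.aestronglyMeasurable.mul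
      (measurable_flowExponent N β m hVd.continuous.measurable hψ.continuous.measurable
        ε).exp.aestronglyMeasurable)
    (by simpa [flowExponent_zero] using hZ)
    (hZ.aestronglyMeasurable.mul
      ((measurable_flowExponent N β m hVd.continuous.measurable hψ.continuous.measurable
        0).exp.mul (measurable_flowExponentDeriv N β m V
          hψ.continuous.measurable 0)).aestronglyMeasurable)
    (Filter.Eventually.of_forall fun lam ε hε => by
      rw [Real.norm_eq_abs, abs_mul, abs_mul, Real.abs_exp]
      gcongr
      · exact hexponent ε hε lam
      · exact hC ε hε lam)
    (hZ.abs.mul_const _)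
    (Filter.Eventually.of_forall fun lam ε hε => (hderiv ε hε lam).exp.const_mul _)).2
  have hzero := hmain.unique <| (hasDerivAt_const (0 : ℝ) _).congr_of_eventuallyEq
    (Filter.eventually_of_mem (Metric.ball_mem_nhds (0 : ℝ) hδ0) hconst)
  simpa only [flowExponent_zero, flowExponentDeriv_zero, Real.exp_zero, one_mul] using hzero

/-- **Ward identity in 1D** (Subsection 3.2 of Akemann–Byun): for a `C²`-smooth potential
`V` growing faster than `log|λ|` at infinity, whose Gibbs measure is a well-defined
probability measure on `ℝ^N`, and any test function `ψ ∈ C_c^∞(ℝ)`, the expectation of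
Ward's functional vanishes: `E_N Ŵ_N^+[ψ] = 0`. -/
theorem ward_identity_1D (N : ℕ) (hN : 2 ≤ N) (β m : ℝ) (hβ : 0 < β) (hm : 0 < m)
    (V : ℝ → ℝ) (hV : ContDiff ℝ 2 V)
    (hgrowth : Filter.Tendsto (fun x : ℝ => V x - Real.log |x|) (Filter.atTop ⊔ Filter.atBot)
      Filter.atTop)
    (hZ : Integrable (weight1D N β m V))
    (hZpos : 0 < Z1D N β m V)
    (ψ : ℝ → ℝ) (hψ : ContDiff ℝ (⊤ : ℕ∞) ψ) (hψc : HasCompactSupport ψ) :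
    ∫ lam : Fin N → ℝ, p1D N β m V lam * ward1D N β m V ψ lam = 0 := by
  simp_rw [p1D, mul_assoc]
  rw [integral_const_mul, integral_weight1D_mul_ward1D N β m (hV.of_le one_le_two) hZ
    (hψ.of_le (by exact_mod_cast le_top)) hψc, mul_zero]
end

section
/- Let c ∈ ℝ, ε > 0, and let G : [0, ε) → (0, ∞) be C² with derivatives extending continuously to 0. Suppose g(r) := G(r²) satisfies the Freud radial mean field equation for α = 1, namely 4πc r g(r) = 2r + (r (log g)'(r))' for all r ∈ (0, √ε). Then the first two Taylor coefficients a₁ = (log G)'(0) and a₂ = ½ (log G)''(0) of log(g/g(0)) in the variable r² are given by a₁ = πc G(0) − 1/2 and a₂ = ¼ (πc G(0))² − ⅛ πc G(0). -/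
open Set Filter Topology

/-- A `C²` function on `[0, ε)` has one-sided derivatives there which are themselves `C¹`. -/
lemma ContDiffOn.exists_hasDerivWithinAt_Ico {ε : ℝ} {L : ℝ → ℝ}
    (hL : ContDiffOn ℝ 2 L (Ico 0 ε)) :
    ∃ L₁ L₂ : ℝ → ℝ, (∀ s ∈ Ico 0 ε, HasDerivWithinAt L (L₁ s) (Ico 0 ε) s) ∧
      (∀ s ∈ Ico 0 ε, HasDerivWithinAt L₁ (L₂ s) (Ico 0 ε) s) ∧ ContinuousOn L₂ (Ico 0 ε) := by
  have hu : UniqueDiffOn ℝ (Ico (0 : ℝ) ε) := uniqueDiffOn_Ico 0 ε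
  have h1 : ContDiffOn ℝ 1 (derivWithin L (Ico 0 ε)) (Ico 0 ε) :=
    hL.derivWithin hu (by norm_num)
  refine ⟨derivWithin L (Ico 0 ε), derivWithin (derivWithin L (Ico 0 ε)) (Ico 0 ε),
    fun s hs => ?_, fun s hs => ?_, ?_⟩
  · exact (hL.differentiableOn (by norm_num) s hs).hasDerivWithinAt
  · exact (h1.differentiableOn (by norm_num) s hs).hasDerivWithinAt
  · exact h1.continuousOn_derivWithin hu (by norm_num)

/-- The radial operator `f ↦ (r f')'` in the variable `s = r²`. -/
lemma deriv_mul_deriv_comp_sq {L L₁ : ℝ → ℝ} {l₂ r : ℝ}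
    (h1 : ∀ᶠ s in 𝓝 (r ^ 2), HasDerivAt L (L₁ s) s) (h2 : HasDerivAt L₁ l₂ (r ^ 2)) :
    deriv (fun x => x * deriv (fun t => L (t ^ 2)) x) r
      = 4 * r * L₁ (r ^ 2) + 4 * r ^ 3 * l₂ := by
  have hsq (x : ℝ) : HasDerivAt (fun t : ℝ => t ^ 2) (2 * x) x := by
    simpa using hasDerivAt_pow 2 x
  have hev : (fun x => x * deriv (fun t => L (t ^ 2)) x) =ᶠ[𝓝 r]
      fun x => (2 * x ^ 2) * L₁ (x ^ 2) := by
    filter_upwards [(hsq r).continuousAt.eventually h1] with x hx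
    have h : HasDerivAt (fun t => L (t ^ 2)) (L₁ (x ^ 2) * (2 * x)) x :=
      HasDerivAt.comp (h₂ := L) x hx (hsq x)
    rw [h.deriv]
    ring
  rw [hev.deriv_eq]
  have h3 : HasDerivAt (fun x => L₁ (x ^ 2)) (l₂ * (2 * r)) r := HasDerivAt.comp r h2 (hsq r)
  refine (((hsq r).const_mul 2).mul h3).deriv.trans ?_
  ring

/-- If `F = b + f + s f'` on `(0, ε)` with `f` being `C¹` up to `0`, then `F(0) = b + f(0)`
and `F'(0) = 2 f'(0)`. -/
lemma eq_and_deriv_eq_of_eq_add_mul_deriv {ε b F' : ℝ} (hε : 0 < ε) {F f f' : ℝ → ℝ}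
    (hF : HasDerivWithinAt F F' (Ico 0 ε) 0) (hf : HasDerivWithinAt f (f' 0) (Ico 0 ε) 0)
    (hf' : ContinuousWithinAt f' (Ico 0 ε) 0)
    (h : ∀ s ∈ Ioo 0 ε, F s = b + f s + s * f' s) :
    F 0 = b + f 0 ∧ F' = 2 * f' 0 := by
  have hle : 𝓝[>] (0 : ℝ) ≤ 𝓝[Ico 0 ε] 0 := by
    rw [← nhdsWithin_Ioo_eq_nhdsGT hε]
    exact nhdsWithin_mono _ Ioo_subset_Ico_self
  have hmem : ∀ᶠ s in 𝓝[>] (0 : ℝ), s ∈ Ioo 0 ε := Ioo_mem_nhdsGT hε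
  have hid : Tendsto (fun s : ℝ => s) (𝓝[>] 0) (𝓝 0) :=
    tendsto_nhdsWithin_of_tendsto_nhds tendsto_id
  have tF := hF.continuousWithinAt.tendsto.mono_left hle
  have tf := hf.continuousWithinAt.tendsto.mono_left hle
  have tf' := hf'.tendsto.mono_left hle
  have h0 : F 0 = b + f 0 := by
    have t := (tf.const_add b).add (hid.mul tf')
    rw [zero_mul, add_zero] at t
    refine tendsto_nhds_unique (tF.congr' ?_) t
    filter_upwards [hmem] with s hs using h s hs
  refine ⟨h0, ?_⟩
  have hslope : 𝓝[>] (0 : ℝ) ≤ 𝓝[Ico 0 ε \ {0}] 0 := by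
    rw [← nhdsWithin_Ioo_eq_nhdsGT hε]
    exact nhdsWithin_mono _ fun s hs => ⟨Ioo_subset_Ico_self hs, hs.1.ne'⟩
  have sF := (hasDerivWithinAt_iff_tendsto_slope.1 hF).mono_left hslope
  have sf := (hasDerivWithinAt_iff_tendsto_slope.1 hf).mono_left hslope
  rw [two_mul]
  refine tendsto_nhds_unique (sF.congr' ?_) (sf.add tf')
  filter_upwards [hmem] with s hs
  have := hs.1.ne'
  rw [slope_def_field, slope_def_field, h s hs, h0]
  field_simp
  ring

/-- **Small-`r` expansion coefficients for the Gaussian potential (α = 1)**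
(eqs. (43)-(44) of Akemann–Byun): if `g(r) = G(r²)` is positive, `C²` up to `0`, and solves
the Freud radial mean field equation `4πc r g = 2r + (r (log g)')'` near the origin, then
the first two Taylor coefficients of `log(g/g(0))` in the variable `r²` are
`a₁ = πc g(0) - 1/2` and `a₂ = ¼(πc g(0))² - ⅛ πc g(0)`. -/
theorem freud_small_r_coefficients_alpha_one (c ε : ℝ) (hε : 0 < ε) (G : ℝ → ℝ)
    (hG : ContDiffOn ℝ 2 G (Set.Ico 0 ε))
    (hGpos : ∀ s ∈ Set.Ico (0 : ℝ) ε, 0 < G s)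
    (hODE : ∀ r ∈ Set.Ioo 0 (Real.sqrt ε),
      4 * Real.pi * c * (r * G (r ^ 2))
        = 2 * r + deriv (fun x => x * deriv (fun t => Real.log (G (t ^ 2))) x) r) :
    derivWithin (fun s => Real.log (G s)) (Set.Ici 0) 0
        = Real.pi * c * G 0 - 1 / 2
      ∧ (1 / 2 : ℝ) * derivWithin
            (derivWithin (fun s => Real.log (G s)) (Set.Ici 0)) (Set.Ici 0) 0
        = (1 / 4) * (Real.pi * c * G 0) ^ 2 - (1 / 8) * (Real.pi * c * G 0) := by
  set L : ℝ → ℝ := fun s => Real.log (G s) with hLdef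
  have hL : ContDiffOn ℝ 2 L (Ico 0 ε) := hG.log fun s hs => (hGpos s hs).ne'
  obtain ⟨L₁, L₂, h1, h2, hc⟩ := hL.exists_hasDerivWithinAt_Ico
  have h0 : (0 : ℝ) ∈ Ico 0 ε := ⟨le_rfl, hε⟩
  have key : ∀ s ∈ Ioo 0 ε, Real.pi * c * G s = 1 / 2 + L₁ s + s * L₂ s := by
    intro s hs
    have hr : 0 < √s := Real.sqrt_pos.2 hs.1
    have hrs : √s ^ 2 = s := Real.sq_sqrt hs.1.le
    have hode := hODE (√s) ⟨hr, Real.sqrt_lt_sqrt hs.1.le hs.2⟩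
    rw [deriv_mul_deriv_comp_sq (L := L) (L₁ := L₁) (l₂ := L₂ s) ?_ ?_, hrs] at hode
    · have h3 : √s ^ 3 = √s * s := by rw [pow_succ, hrs, mul_comm]
      rw [h3] at hode
      refine mul_left_cancel₀ (mul_pos four_pos hr).ne' ?_
      linear_combination hode
    · rw [hrs]
      filter_upwards [Ioo_mem_nhds hs.1 hs.2] with t ht
      exact (h1 t (Ioo_subset_Ico_self ht)).hasDerivAt (Ico_mem_nhds ht.1 ht.2)
    · rw [hrs]
      exact (h2 s (Ioo_subset_Ico_self hs)).hasDerivAt (Ico_mem_nhds hs.1 hs.2)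
  have hG' : HasDerivWithinAt G (G 0 * L₁ 0) (Ico 0 ε) 0 := by
    have hexp : ∀ s ∈ Ico 0 ε, G s = Real.exp (L s) := fun s hs =>
      (Real.exp_log (hGpos s hs)).symm
    rw [hexp 0 h0]
    exact (h1 0 h0).exp.congr hexp (hexp 0 h0)
  obtain ⟨e1, e2⟩ := eq_and_deriv_eq_of_eq_add_mul_deriv hε (hG'.const_mul (Real.pi * c))
    (h2 0 h0) (hc 0 h0) key
  have hIci {f : ℝ → ℝ} {f' s : ℝ} (hs : s ∈ Ico 0 ε)
      (hf : HasDerivWithinAt f f' (Ico 0 ε) s) : derivWithin f (Ici 0) s = f' := by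
    refine (hf.mono_of_mem_nhdsWithin ?_).derivWithin (uniqueDiffOn_Ici 0 s hs.1)
    rw [← Ici_inter_Iio]
    exact inter_mem self_mem_nhdsWithin (mem_nhdsWithin_of_mem_nhds (Iio_mem_nhds hs.2))
  have hD : ∀ s ∈ Ico 0 ε, derivWithin L (Ici 0) s = L₁ s := fun s hs => hIci hs (h1 s hs)
  rw [hIci h0 ((h2 0 h0).congr hD (hD 0 h0)), hD 0 h0]
  have e3 : L₁ 0 = Real.pi * c * G 0 - 1 / 2 := by linear_combination -e1
  refine ⟨e3, ?_⟩
  rw [e3] at e2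
  linear_combination -e2 / 4
end
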